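/- There is no Lebesgue measurable function u : (0,1) → ℝ satisfying both: (i) ∫₀¹ x^{α−1} (1−x)^{−1/2} |u(x)| dx < ∞ for every α > 0, and (ii) (1−y)^{−1/2} = ∫_y^1 u(x) · x^{−1} (1−x)^{−1/2} dx for every y ∈ (0,1). -/

import Mathlib

open MeasureTheory Set

/-- Nonexistence of an unbiased estimator of the shape parameter for sample size `n = 2`:
no Lebesgue measurable `u : (0,1) → ℝ` with `∫₀¹ x^{α−1}(1−x)^{−1/2}|u(x)| dx < ∞` for all
`α > 0` can satisfy `(1−y)^{−1/2} = ∫_y^1 u(x) x^{−1} (1−x)^{−1/2} dx` for all `y ∈ (0,1)`. -/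
theorem no_unbiased_estimator_shape_n_two :
    ¬ ∃ u : ℝ → ℝ, AEMeasurable u volume ∧
      (∀ a > (0:ℝ),
        IntegrableOn (fun x => x ^ (a - 1) * (1 - x) ^ (-(1:ℝ)/2) * |u x|) (Ioo 0 1)) ∧
      (∀ y ∈ Ioo (0:ℝ) 1,
        (1 - y) ^ (-(1:ℝ)/2) = ∫ x in Ioo y 1, u x * (x⁻¹ * (1 - x) ^ (-(1:ℝ)/2))) := by
  rintro ⟨u, -, hfin, heq⟩
  set g : ℝ → ℝ := fun x => x ^ ((1:ℝ) - 1) * (1 - x) ^ (-(1:ℝ)/2) * |u x| with hg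
  have hgi : IntegrableOn g (Ioo 0 1) := hfin 1 one_pos
  have hg0 : ∀ x ∈ Ioo (0:ℝ) 1, 0 ≤ g x := fun x hx =>
    mul_nonneg (mul_nonneg (Real.rpow_nonneg hx.1.le _)
      (Real.rpow_nonneg (sub_nonneg.2 hx.2.le) _)) (abs_nonneg _)
  set C : ℝ := ∫ x in Ioo 0 1, g x with hC
  have hC0 : 0 ≤ C := setIntegral_nonneg measurableSet_Ioo hg0
  set y : ℝ := 1 - ((2 * C + 2) ^ 2)⁻¹ with hy
  have hinv : ((2 * C + 2) ^ 2)⁻¹ ≤ 1 / 2 := by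
    rw [inv_le_comm₀ (by positivity) (by norm_num)]
    nlinarith
  have hy1 : y < 1 := by
    have : 0 < ((2 * C + 2) ^ 2)⁻¹ := by positivity
    linarith
  have hy2 : 1 / 2 ≤ y := by linarith
  have hleft : (1 - y) ^ (-(1:ℝ)/2) = 2 * C + 2 := by
    rw [hy, sub_sub_cancel, Real.inv_rpow (by positivity), ← Real.rpow_natCast,
      ← Real.rpow_mul (by positivity), ← Real.rpow_neg (by positivity)]
    norm_num
  have hsub : Ioo y 1 ⊆ Ioo 0 1 := Ioo_subset_Ioo_left (by linarith)
  have hbound : ‖∫ x in Ioo y 1, u x * (x⁻¹ * (1 - x) ^ (-(1:ℝ)/2))‖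
      ≤ ∫ x in Ioo y 1, 2 * g x := by
    refine norm_integral_le_of_norm_le ((hgi.mono_set hsub).const_mul 2) ?_
    filter_upwards [ae_restrict_mem measurableSet_Ioo] with x hx
    have hx0 : 0 < x := (hsub hx).1
    have hp : 0 ≤ (1 - x) ^ (-(1:ℝ)/2) := Real.rpow_nonneg (sub_nonneg.2 hx.2.le) _
    have hxi : x⁻¹ ≤ 2 := by
      rw [inv_le_comm₀ hx0 two_pos]
      linarith [hx.1]
    rw [norm_mul, norm_mul, Real.norm_eq_abs, Real.norm_of_nonneg (inv_nonneg.2 hx0.le),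
      Real.norm_of_nonneg hp]
    calc |u x| * (x⁻¹ * (1 - x) ^ (-(1:ℝ)/2)) ≤ |u x| * (2 * (1 - x) ^ (-(1:ℝ)/2)) := by gcongr
      _ = 2 * g x := by
        simp only [hg, sub_self, Real.rpow_zero]
        ring
  have hmono : ∫ x in Ioo y 1, g x ≤ C :=
    setIntegral_mono_set hgi ((ae_restrict_iff' measurableSet_Ioo).2 (.of_forall hg0))
      hsub.eventuallyLE
  rw [← heq y ⟨by linarith, hy1⟩, hleft, integral_const_mul] at hbound
  linarith [Real.le_norm_self (2 * C + 2)]
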